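/- Weighted fractional Orlicz–Hardy inequality away from the origin: let N ≥ 1, s ∈ (0,1), α₁, α₂ ∈ ℝ, γ = s − α₁ − α₂, and let Φ be an Orlicz function with p⁻ = inf_{t>0} tφ(t)/Φ(t). If γ > N/p⁻, then there exists C > 0 such that ∫_{ℝ^N} Φ(|u(x)|/|x|^γ) dx ≤ C ∫_{ℝ^N}∫_{ℝ^N} Φ(|x|^{α₁}|y|^{α₂}|u(x)−u(y)|/|x−y|^s) dx dy/|x−y|^N for all u ∈ C_c¹(ℝ^N \ {0}). -/

import Mathlib

open Set Filter MeasureTheory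

/-- An Orlicz function `Φ` together with its right derivative `φ`:
`Φ` is continuous, convex on `[0,∞)`, vanishes at `0`, satisfies
`Φ(t)/t → 0` as `t → 0⁺`, `Φ(t)/t → ∞` as `t → ∞`, the Δ₂-condition,
and has the representation `Φ(t) = ∫₀ᵗ φ(s) ds` with `φ` non-decreasing,
right-continuous, `φ(0) = 0`, `φ(t) > 0` for `t > 0`, `φ(t) → ∞`. -/
structure IsOrliczPair (Φ φ : ℝ → ℝ) : Prop where
  continuousOn : ContinuousOn Φ (Ici 0)
  convexOn : ConvexOn ℝ (Ici 0) Φ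
  map_zero : Φ 0 = 0
  tendsto_zero : Tendsto (fun t => Φ t / t) (nhdsWithin 0 (Ioi 0)) (nhds 0)
  tendsto_atTop : Tendsto (fun t => Φ t / t) atTop atTop
  delta2 : ∃ C > 0, ∀ t ≥ 0, Φ (2 * t) ≤ C * Φ t
  rep : ∀ t ≥ 0, Φ t = ∫ s in (0:ℝ)..t, φ s
  deriv_mono : MonotoneOn φ (Ici 0)
  deriv_rightCont : ∀ t ≥ 0, ContinuousWithinAt φ (Ici t) t
  deriv_zero : φ 0 = 0
  deriv_pos : ∀ t > 0, 0 < φ t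
  deriv_atTop : Tendsto φ atTop atTop

/-- The set of values `t·φ(t)/Φ(t)` for `t > 0`, whose infimum and supremum
are `p⁻_Φ` and `p⁺_Φ`. -/
def orliczRatioSet (Φ φ : ℝ → ℝ) : Set ℝ := {r : ℝ | ∃ t > 0, r = t * φ t / Φ t}

namespace IsOrliczPair

variable {Φ φ : ℝ → ℝ}

theorem intervalIntegrable (h : IsOrliczPair Φ φ) {a b : ℝ} (ha : 0 ≤ a) (hb : 0 ≤ b) :
    IntervalIntegrable φ volume a b :=
  (h.deriv_mono.mono fun _ hx => (le_min ha hb).trans hx.1).intervalIntegrable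

theorem deriv_nonneg (h : IsOrliczPair Φ φ) {t : ℝ} (ht : 0 ≤ t) : 0 ≤ φ t := by
  rcases ht.eq_or_lt with rfl | ht
  · exact h.deriv_zero.ge
  · exact (h.deriv_pos t ht).le

theorem pos (h : IsOrliczPair Φ φ) {t : ℝ} (ht : 0 < t) : 0 < Φ t := by
  rw [h.rep t ht.le]
  exact intervalIntegral.intervalIntegral_pos_of_pos_on (h.intervalIntegrable le_rfl ht.le)
    (fun x hx => h.deriv_pos x hx.1) ht

theorem nonneg (h : IsOrliczPair Φ φ) {t : ℝ} (ht : 0 ≤ t) : 0 ≤ Φ t := by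
  rcases ht.eq_or_lt with rfl | ht
  · exact h.map_zero.ge
  · exact (h.pos ht).le

theorem mono (h : IsOrliczPair Φ φ) {a b : ℝ} (ha : 0 ≤ a) (hab : a ≤ b) : Φ a ≤ Φ b := by
  have hb := ha.trans hab
  have hadd := intervalIntegral.integral_add_adjacent_intervals
    (h.intervalIntegrable le_rfl ha) (h.intervalIntegrable ha hb)
  rw [h.rep a ha, h.rep b hb, ← hadd]
  have := intervalIntegral.integral_nonneg hab (f := φ) (μ := volume)
    (fun x hx => h.deriv_nonneg (ha.trans hx.1))
  linarith

theorem le_mul_deriv (h : IsOrliczPair Φ φ) {t : ℝ} (ht : 0 ≤ t) : Φ t ≤ t * φ t := by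
  rw [h.rep t ht]
  have := intervalIntegral.integral_mono_on ht (h.intervalIntegrable le_rfl ht)
    (intervalIntegrable_const (c := φ t)) (fun x hx => h.deriv_mono hx.1 ht hx.2)
  simpa using this

theorem hasDerivWithinAt (h : IsOrliczPair Φ φ) {t : ℝ} (ht : 0 ≤ t) :
    HasDerivWithinAt Φ (φ t) (Ici t) t := by
  have hmeas : StronglyMeasurableAtFilter φ (nhdsWithin t (Ioi t)) volume :=
    ⟨Ioc t (t + 1), Ioc_mem_nhdsGT (by linarith),
      (h.intervalIntegrable ht (by linarith : 0 ≤ t + 1)).1.aestronglyMeasurable⟩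
  have := intervalIntegral.integral_hasDerivWithinAt_right (s := Ici t) (t := Ioi t)
    (h.intervalIntegrable le_rfl ht) hmeas ((h.deriv_rightCont t ht).mono Ioi_subset_Ici_self)
  exact this.congr (fun x hx => h.rep x (ht.trans hx)) (h.rep t ht)

theorem one_le_of_isGLB (h : IsOrliczPair Φ φ) {p : ℝ} (hp : IsGLB (orliczRatioSet Φ φ) p) :
    1 ≤ p := by
  refine hp.2 ?_
  rintro _ ⟨t, ht, rfl⟩
  rw [one_le_div (h.pos ht)]
  exact h.le_mul_deriv ht.le

theorem mul_le_mul_deriv (h : IsOrliczPair Φ φ) {p : ℝ} (hp : IsGLB (orliczRatioSet Φ φ) p)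
    {t : ℝ} (ht : 0 < t) : p * Φ t ≤ t * φ t :=
  (le_div_iff₀ (h.pos ht)).1 (hp.1 ⟨t, ht, rfl⟩)

theorem mul_rpow_neg_le (h : IsOrliczPair Φ φ) {p : ℝ} (hp : IsGLB (orliczRatioSet Φ φ) p)
    {a b : ℝ} (ha : 0 < a) (hab : a ≤ b) : Φ a * a ^ (-p) ≤ Φ b * b ^ (-p) := by
  have hcont : ContinuousOn (fun t => -(Φ t * t ^ (-p))) (Icc a b) := by
    refine ((h.continuousOn.mono fun x hx => ha.le.trans hx.1).mul ?_).neg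
    exact continuousOn_id.rpow_const fun x hx => Or.inl (ha.trans_le hx.1).ne'
  have hderiv : ∀ x ∈ Ico a b, HasDerivWithinAt (fun t => -(Φ t * t ^ (-p)))
      (-(φ x * x ^ (-p) + Φ x * (-p * x ^ (-p - 1)))) (Ici x) x := fun x hx =>
    ((h.hasDerivWithinAt (ha.le.trans hx.1)).mul
      (Real.hasDerivAt_rpow_const (Or.inl (ha.trans_le hx.1).ne')).hasDerivWithinAt).neg
  have := image_le_of_deriv_right_le_deriv_boundary hcont hderiv
    (B := fun _ => -(Φ a * a ^ (-p))) (B' := fun _ => 0) le_rfl continuousOn_const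
    (fun x _ => hasDerivWithinAt_const ..) ?_ (right_mem_Icc.2 hab)
  · simpa using this
  · intro x hx
    have hx0 : 0 < x := ha.trans_le hx.1
    have hle := h.mul_le_mul_deriv hp hx0
    have hsplit : x ^ (-p) = x * x ^ (-p - 1) := by
      rw [Real.rpow_sub_one hx0.ne', mul_div_cancel₀ _ hx0.ne']
    have hnn : 0 ≤ (x * φ x - p * Φ x) * x ^ (-p - 1) :=
      mul_nonneg (by linarith) (Real.rpow_nonneg hx0.le _)
    rw [hsplit]
    linarith

theorem map_mul_le (h : IsOrliczPair Φ φ) {p : ℝ} (hp : IsGLB (orliczRatioSet Φ φ) p)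
    {c t : ℝ} (hc : 0 < c) (hc1 : c ≤ 1) (ht : 0 ≤ t) : Φ (c * t) ≤ c ^ p * Φ t := by
  rcases ht.eq_or_lt with rfl | ht
  · simp [h.map_zero]
  have := h.mul_rpow_neg_le hp (mul_pos hc ht) (mul_le_of_le_one_left ht.le hc1)
  rw [Real.mul_rpow hc.le ht.le, Real.rpow_neg hc.le, ← mul_assoc] at this
  have := le_of_mul_le_mul_right this (Real.rpow_pos_of_pos ht _)
  rwa [← div_eq_mul_inv, div_le_iff₀ (Real.rpow_pos_of_pos hc _), mul_comm (Φ t)] at this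

theorem exists_map_mul_le (h : IsOrliczPair Φ φ) (k : ℝ) :
    ∃ D > 0, ∀ t ≥ 0, ∀ r, 0 ≤ r → r ≤ k * t → Φ r ≤ D * Φ t := by
  obtain ⟨C, hC, hdbl⟩ := h.delta2
  obtain ⟨n, hn⟩ := pow_unbounded_of_one_lt k one_lt_two
  have hpow : ∀ n : ℕ, ∀ t ≥ 0, Φ (2 ^ n * t) ≤ C ^ n * Φ t := by
    intro n
    induction n with
    | zero => simp
    | succ n ih =>
      intro t ht
      calc Φ (2 ^ (n + 1) * t) = Φ (2 * (2 ^ n * t)) := by ring_nf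
        _ ≤ C * Φ (2 ^ n * t) := hdbl _ (by positivity)
        _ ≤ C * (C ^ n * Φ t) := by gcongr; exact ih t ht
        _ = C ^ (n + 1) * Φ t := by ring
  refine ⟨C ^ n, by positivity, fun t ht r hr hrt => ?_⟩
  exact (h.mono hr (hrt.trans (by gcongr))).trans (hpow n t ht)

theorem exists_map_add_le (h : IsOrliczPair Φ φ) :
    ∃ D > 0, ∀ a ≥ 0, ∀ b ≥ 0, ∀ r, 0 ≤ r → r ≤ a + b → Φ r ≤ D * (Φ a + Φ b) := by
  obtain ⟨D, hD, hle⟩ := h.exists_map_mul_le 2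
  refine ⟨D, hD, fun a ha b hb r hr hrab => ?_⟩
  have := h.nonneg ha
  have := h.nonneg hb
  rcases le_total a b with hab | hab
  · exact (hle b hb r hr (by linarith)).trans (by gcongr; linarith)
  · exact (hle a ha r hr (by linarith)).trans (by gcongr; linarith)

theorem measurable_comp (h : IsOrliczPair Φ φ) {X : Type*} [MeasurableSpace X] {f : X → ℝ}
    (hf : Measurable f) (hf0 : ∀ x, 0 ≤ f x) : Measurable fun x => Φ (f x) := by
  have habs : Continuous fun t : ℝ => Φ |t| :=
    h.continuousOn.comp_continuous continuous_abs fun t => abs_nonneg t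
  simpa only [Function.comp_def, abs_of_nonneg (hf0 _)] using habs.measurable.comp hf

end IsOrliczPair

section Annulus

variable {N : ℕ}

theorem volume_closedBall_zero_eq (r : ℝ) (hr : 0 ≤ r) :
    volume (Metric.closedBall (0 : EuclideanSpace ℝ (Fin N)) r) = ENNReal.ofReal
      (r ^ N * (volume (Metric.ball (0 : EuclideanSpace ℝ (Fin N)) 1)).toReal) := by
  rw [Measure.addHaar_closedBall _ _ hr, finrank_euclideanSpace_fin,
    ENNReal.ofReal_mul (by positivity), ENNReal.ofReal_toReal measure_ball_lt_top.ne]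

theorem le_volume_annulus (hN : 1 ≤ N) (r : ℝ) (hr : 0 ≤ r) :
    ENNReal.ofReal
      (r ^ N * (volume (Metric.ball (0 : EuclideanSpace ℝ (Fin N)) 1)).toReal / 2) ≤
      volume {y : EuclideanSpace ℝ (Fin N) | r / 2 < ‖y‖ ∧ ‖y‖ ≤ r} := by
  set v := (volume (Metric.ball (0 : EuclideanSpace ℝ (Fin N)) 1)).toReal with hv
  have hv0 : 0 ≤ v := ENNReal.toReal_nonneg
  have heq : {y : EuclideanSpace ℝ (Fin N) | r / 2 < ‖y‖ ∧ ‖y‖ ≤ r} =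
      Metric.closedBall 0 r \ Metric.closedBall 0 (r / 2) := by
    ext y
    simp [and_comm]
  rw [heq]
  refine le_trans ?_ (le_measure_sdiff ..)
  rw [volume_closedBall_zero_eq r hr, volume_closedBall_zero_eq (r / 2) (by linarith), ← hv,
    ← ENNReal.ofReal_sub _ (by positivity)]
  refine ENNReal.ofReal_le_ofReal ?_
  have h2 : (2 : ℝ) ≤ 2 ^ N := by simpa using pow_le_pow_right₀ (one_le_two (α := ℝ)) hN
  have : (r / 2) ^ N ≤ r ^ N / 2 := by rw [div_pow]; gcongr
  nlinarith

end Annulus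

theorem lintegral_orlicz_ne_top {Φ φ : ℝ → ℝ} (h : IsOrliczPair Φ φ) {N : ℕ} (γ : ℝ)
    {u : EuclideanSpace ℝ (Fin N) → ℝ} (hu : Continuous u) (hc : HasCompactSupport u)
    (h0 : (0 : EuclideanSpace ℝ (Fin N)) ∉ tsupport u) :
    (∫⁻ x, ENNReal.ofReal (Φ (|u x| / ‖x‖ ^ γ))) ≠ ⊤ := by
  have hcont : ContinuousOn (fun x => Φ (|u x| / ‖x‖ ^ γ)) (tsupport u) := by
    have hne : ∀ x ∈ tsupport u, ‖x‖ ≠ 0 := fun x hx hx0 => h0 (norm_eq_zero.1 hx0 ▸ hx)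
    refine h.continuousOn.comp (t := Ici 0) ?_ fun x _ => by simp only [mem_Ici]; positivity
    refine hu.abs.continuousOn.div
      (continuous_norm.continuousOn.rpow_const fun x hx => Or.inl (hne x hx)) fun x hx => ?_
    exact (Real.rpow_pos_of_pos ((norm_nonneg x).lt_of_ne' (hne x hx)) _).ne'
  have hint := hcont.integrableOn_compact (μ := volume) hc.isCompact
  have hsupp : Function.support (fun x => ENNReal.ofReal (Φ (|u x| / ‖x‖ ^ γ))) ⊆ tsupport u := by
    refine Function.support_subset_iff'.2 fun x hx => ?_
    simp [image_eq_zero_of_notMem_tsupport hx, h.map_zero]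
  rw [← setLIntegral_eq_of_support_subset hsupp]
  exact (hint.lintegral_lt_top).ne

theorem min_rpow_le_rpow {a b r : ℝ} (ha : 0 < a) (har : a ≤ r) (hrb : r ≤ b) (α : ℝ) :
    min (a ^ α) (b ^ α) ≤ r ^ α := by
  rcases le_total 0 α with hα | hα
  · exact (min_le_left _ _).trans (Real.rpow_le_rpow ha.le har hα)
  · exact (min_le_right _ _).trans (Real.rpow_le_rpow_of_nonpos (ha.trans_le har) hrb hα)

theorem exists_div_rpow_le_weighted_quotient {E : Type*} [NormedAddCommGroup E]
    {M s α₁ α₂ : ℝ} (hM : 1 < M) (hs : 0 ≤ s) :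
    ∃ k > 0, ∀ x y : E, 0 < ‖x‖ → ‖x‖ / M / 2 < ‖y‖ → ‖y‖ ≤ ‖x‖ / M → ∀ d : ℝ, 0 ≤ d →
      d / ‖x‖ ^ (s - α₁ - α₂) ≤ k * (‖x‖ ^ α₁ * ‖y‖ ^ α₂ * (d / ‖x - y‖ ^ s)) := by
  have hM0 : 0 < M := one_pos.trans hM
  set c := min ((1 / M / 2) ^ α₂) ((1 / M) ^ α₂) with hc
  have hc0 : 0 < c := lt_min (by positivity) (by positivity)
  refine ⟨2 ^ s / c, by positivity, fun x y hx hy1 hy2 d hd => ?_⟩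
  have hyx : ‖y‖ < ‖x‖ := hy2.trans_lt (div_lt_self hx hM)
  have hxy0 : 0 < ‖x - y‖ := by linarith [norm_sub_norm_le x y]
  have hxy : ‖x - y‖ ≤ 2 * ‖x‖ := by linarith [norm_sub_le x y]
  have hy : c * ‖x‖ ^ α₂ ≤ ‖y‖ ^ α₂ := by
    have := min_rpow_le_rpow (b := 1 / M) (r := ‖y‖ / ‖x‖)
      (show 0 < 1 / M / 2 by positivity)
      (by rw [le_div_iff₀ hx]; convert hy1.le using 1; ring)
      (by rw [div_le_iff₀ hx]; rwa [one_div_mul_eq_div]) α₂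
    rwa [Real.div_rpow (norm_nonneg y) hx.le, le_div_iff₀ (by positivity)] at this
  have hxys : ‖x - y‖ ^ s ≤ 2 ^ s * ‖x‖ ^ s := by
    rw [← Real.mul_rpow zero_le_two hx.le]
    exact Real.rpow_le_rpow hxy0.le hxy hs
  calc d / ‖x‖ ^ (s - α₁ - α₂)
      = 2 ^ s / c * (‖x‖ ^ α₁ * (c * ‖x‖ ^ α₂) * (d / (2 ^ s * ‖x‖ ^ s))) := by
        rw [Real.rpow_sub hx, Real.rpow_sub hx]
        field_simp
    _ ≤ 2 ^ s / c * (‖x‖ ^ α₁ * ‖y‖ ^ α₂ * (d / ‖x - y‖ ^ s)) := by gcongr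

theorem exists_large_dilation {D B p γ : ℝ} (hcrit : B < γ * p) :
    ∃ M > 1, D * ((1 / M) ^ γ) ^ p ≤ (1 / M) ^ B := by
  have hev := (tendsto_rpow_atTop (sub_pos.2 hcrit)).eventually_ge_atTop D
  obtain ⟨M, hD, hM⟩ := (hev.and (eventually_gt_atTop 1)).exists
  have hM0 : 0 < M := one_pos.trans hM
  refine ⟨M, hM, ?_⟩
  rw [← Real.rpow_mul (by positivity), Real.div_rpow zero_le_one hM0.le,
    Real.div_rpow zero_le_one hM0.le, Real.one_rpow, Real.one_rpow, mul_one_div,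
    div_le_div_iff₀ (by positivity) (by positivity), one_mul]
  calc D * M ^ B ≤ M ^ (γ * p - B) * M ^ B := by gcongr
    _ = M ^ (γ * p) := by rw [← Real.rpow_add hM0]; ring_nf

/-- Comparison of the Hardy integrand at `x` with its value at a point `y` of the annulus
`{‖x‖ / (2M) < ‖y‖ ≤ ‖x‖ / M}`. -/
theorem exists_hardy_integrand_le {Φ φ : ℝ → ℝ} (h : IsOrliczPair Φ φ) {p : ℝ}
    (hp : IsGLB (orliczRatioSet Φ φ) p) (E : Type*) [NormedAddCommGroup E] (N : ℕ)
    {s α₁ α₂ : ℝ} (hs : 0 ≤ s) (hγ : 0 ≤ s - α₁ - α₂) :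
    ∃ D > 0, ∀ M > 1, ∃ K > 0, ∀ (u : E → ℝ) (x y : E), 0 < ‖x‖ →
      ‖x‖ / M / 2 < ‖y‖ → ‖y‖ ≤ ‖x‖ / M →
      Φ (|u x| / ‖x‖ ^ (s - α₁ - α₂)) / ‖x‖ ^ N ≤
        D * ((1 / M) ^ (s - α₁ - α₂)) ^ p * (1 / M) ^ N *
            (Φ (|u y| / ‖y‖ ^ (s - α₁ - α₂)) / ‖y‖ ^ N) +
          K * (Φ (‖x‖ ^ α₁ * ‖y‖ ^ α₂ * (|u x - u y| / ‖x - y‖ ^ s)) / ‖x - y‖ ^ (N : ℝ)) := by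
  obtain ⟨D, hD, hadd⟩ := h.exists_map_add_le
  refine ⟨D, hD, fun M hM => ?_⟩
  obtain ⟨k, hk, hquot⟩ :=
    exists_div_rpow_le_weighted_quotient (E := E) (α₁ := α₁) (α₂ := α₂) hM hs
  obtain ⟨L, hL, hmul⟩ := h.exists_map_mul_le k
  refine ⟨D * L * 2 ^ N, by positivity, fun u x y hx hy1 hy2 => ?_⟩
  set γ := s - α₁ - α₂
  have hM0 : 0 < M := one_pos.trans hM
  have hy0 : 0 < ‖y‖ := lt_trans (by positivity) hy1
  have hyx : ‖y‖ < ‖x‖ := hy2.trans_lt (div_lt_self hx hM)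
  have hxy0 : 0 < ‖x - y‖ := by linarith [norm_sub_norm_le x y]
  have hxy : ‖x - y‖ ≤ 2 * ‖x‖ := by linarith [norm_sub_le x y]
  have hle : 1 / ‖x‖ ≤ 1 / M * (1 / ‖y‖) := by
    rw [one_div_mul_one_div]
    gcongr
    rwa [mul_comm, ← le_div_iff₀ hM0]
  have hMγ : (1 / M) ^ γ ≤ 1 := Real.rpow_le_one (by positivity) ((div_le_one hM0).2 hM.le) hγ
  have hfst : Φ (|u y| / ‖x‖ ^ γ) ≤ ((1 / M) ^ γ) ^ p * Φ (|u y| / ‖y‖ ^ γ) := by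
    refine le_trans (h.mono (by positivity) ?_)
      (h.map_mul_le hp (by positivity) hMγ (by positivity))
    have := Real.rpow_le_rpow (by positivity) hle hγ
    rw [Real.mul_rpow (by positivity) (by positivity), Real.div_rpow zero_le_one hx.le,
      Real.div_rpow zero_le_one hy0.le, Real.one_rpow] at this
    calc |u y| / ‖x‖ ^ γ = |u y| * (1 / ‖x‖ ^ γ) := by ring
      _ ≤ |u y| * ((1 / M) ^ γ * (1 / ‖y‖ ^ γ)) := by gcongr
      _ = (1 / M) ^ γ * (|u y| / ‖y‖ ^ γ) := by ring
  have hsnd := hmul (‖x‖ ^ α₁ * ‖y‖ ^ α₂ * (|u x - u y| / ‖x - y‖ ^ s)) (by positivity)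
    (|u x - u y| / ‖x‖ ^ γ) (by positivity) (hquot x y hx hy1 hy2 _ (abs_nonneg _))
  have htri : |u x| / ‖x‖ ^ γ ≤ |u y| / ‖x‖ ^ γ + |u x - u y| / ‖x‖ ^ γ := by
    rw [← add_div]
    gcongr
    linarith [abs_sub_abs_le_abs_sub (u x) (u y)]
  have hsum := hadd _ (by positivity) _ (by positivity) _ (by positivity) htri
  set W := ‖x‖ ^ α₁ * ‖y‖ ^ α₂ * (|u x - u y| / ‖x - y‖ ^ s)
  have hW : 0 ≤ Φ W := h.nonneg (by positivity)
  have hF : 0 ≤ Φ (|u y| / ‖y‖ ^ γ) := h.nonneg (by positivity)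
  have hNy : 1 / ‖x‖ ^ N ≤ (1 / M) ^ N * (1 / ‖y‖ ^ N) := by
    rw [← one_div_pow, ← one_div_pow, ← mul_pow]
    gcongr
  have hNxy : 1 / ‖x‖ ^ N ≤ 2 ^ N * (1 / ‖x - y‖ ^ N) := by
    rw [mul_one_div, div_le_div_iff₀ (by positivity) (by positivity), one_mul, ← mul_pow]
    gcongr
  rw [Real.rpow_natCast]
  calc Φ (|u x| / ‖x‖ ^ γ) / ‖x‖ ^ N
      ≤ D * (((1 / M) ^ γ) ^ p * Φ (|u y| / ‖y‖ ^ γ) + L * Φ W) / ‖x‖ ^ N := by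
        gcongr
        exact hsum.trans (by gcongr)
    _ = D * ((1 / M) ^ γ) ^ p * Φ (|u y| / ‖y‖ ^ γ) * (1 / ‖x‖ ^ N) +
          D * L * Φ W * (1 / ‖x‖ ^ N) := by ring
    _ ≤ D * ((1 / M) ^ γ) ^ p * Φ (|u y| / ‖y‖ ^ γ) * ((1 / M) ^ N * (1 / ‖y‖ ^ N)) +
          D * L * Φ W * (2 ^ N * (1 / ‖x - y‖ ^ N)) := by gcongr
    _ = _ := by ring

/-- If `f` is dominated along the annuli `{‖x‖ / (2M) < ‖y‖ ≤ ‖x‖ / M}` by a multiple of itself and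
a kernel, then the same holds for the integrals. -/
theorem lintegral_le_of_annulus_comparison {N : ℕ} (hN : 1 ≤ N) {M a K : ℝ} (hM : 0 < M)
    (ha : 0 ≤ a) (hK : 0 ≤ K) {f : EuclideanSpace ℝ (Fin N) → ℝ}
    (hf : Measurable f) (hf0 : ∀ x, 0 ≤ f x) (hzero : f 0 = 0)
    {G : EuclideanSpace ℝ (Fin N) → EuclideanSpace ℝ (Fin N) → ℝ}
    (hle : ∀ x y, 0 < ‖x‖ → ‖x‖ / M / 2 < ‖y‖ → ‖y‖ ≤ ‖x‖ / M →
      f x / ‖x‖ ^ N ≤ a * (f y / ‖y‖ ^ N) + K * G x y) :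
    ENNReal.ofReal
        ((1 / M) ^ N * (volume (Metric.ball (0 : EuclideanSpace ℝ (Fin N)) 1)).toReal / 2) *
        ∫⁻ x, ENNReal.ofReal (f x) ≤
      ENNReal.ofReal
          (a * (2 * M) ^ N * (volume (Metric.ball (0 : EuclideanSpace ℝ (Fin N)) 1)).toReal) *
          (∫⁻ x, ENNReal.ofReal (f x)) +
        ENNReal.ofReal K * ∫⁻ x, ∫⁻ y, ENNReal.ofReal (G x y) := by
  set v := (volume (Metric.ball (0 : EuclideanSpace ℝ (Fin N)) 1)).toReal with hv
  have hv0 : 0 ≤ v := ENNReal.toReal_nonneg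
  let S : Set (EuclideanSpace ℝ (Fin N) × EuclideanSpace ℝ (Fin N)) :=
    {z | ‖z.1‖ / M / 2 < ‖z.2‖ ∧ ‖z.2‖ ≤ ‖z.1‖ / M}
  have hS : MeasurableSet S := by
    have hfst : Measurable fun z : EuclideanSpace ℝ (Fin N) × EuclideanSpace ℝ (Fin N) =>
      ‖z.1‖ / M := by fun_prop
    exact (measurableSet_lt (hfst.div_const 2) measurable_snd.norm).inter
      (measurableSet_le measurable_snd.norm hfst)
  let A : EuclideanSpace ℝ (Fin N) × EuclideanSpace ℝ (Fin N) → ENNReal :=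
    S.indicator fun z => ENNReal.ofReal (a * (f z.2 / ‖z.2‖ ^ N))
  have hA : Measurable A := Measurable.indicator (by fun_prop) hS
  have hpoint : ∀ x, ENNReal.ofReal ((1 / M) ^ N * v / 2) * ENNReal.ofReal (f x) ≤
      (∫⁻ y, A (x, y)) + ENNReal.ofReal K * ∫⁻ y, ENNReal.ofReal (G x y) := by
    intro x
    rcases eq_or_ne x 0 with rfl | hx
    · simp [hzero]
    have hx0 : 0 < ‖x‖ := norm_pos_iff.2 hx
    have hSx : MeasurableSet {y | ‖x‖ / M / 2 < ‖y‖ ∧ ‖y‖ ≤ ‖x‖ / M} :=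
      measurable_prodMk_left hS
    calc ENNReal.ofReal ((1 / M) ^ N * v / 2) * ENNReal.ofReal (f x)
        = ENNReal.ofReal (f x / ‖x‖ ^ N) * ENNReal.ofReal ((‖x‖ / M) ^ N * v / 2) := by
          rw [← ENNReal.ofReal_mul (by positivity),
            ← ENNReal.ofReal_mul (div_nonneg (hf0 x) (by positivity)), div_pow, div_pow, one_pow]
          congr 1
          field_simp
      _ ≤ ENNReal.ofReal (f x / ‖x‖ ^ N) *
            volume {y : EuclideanSpace ℝ (Fin N) | ‖x‖ / M / 2 < ‖y‖ ∧ ‖y‖ ≤ ‖x‖ / M} := by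
          gcongr
          exact le_volume_annulus hN _ (by positivity)
      _ = ∫⁻ y, {y | ‖x‖ / M / 2 < ‖y‖ ∧ ‖y‖ ≤ ‖x‖ / M}.indicator
            (fun _ => ENNReal.ofReal (f x / ‖x‖ ^ N)) y := by
          rw [lintegral_indicator_const hSx]
      _ ≤ ∫⁻ y, (A (x, y) + ENNReal.ofReal K * ENNReal.ofReal (G x y)) := by
          refine lintegral_mono fun y => indicator_apply_le' (fun hy => ?_) fun _ => zero_le
          have hAxy : A (x, y) = ENNReal.ofReal (a * (f y / ‖y‖ ^ N)) :=
            indicator_of_mem (show (x, y) ∈ S from hy) _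
          rw [hAxy, ← ENNReal.ofReal_mul hK]
          exact (ENNReal.ofReal_le_ofReal (hle x y hx0 hy.1 hy.2)).trans ENNReal.ofReal_add_le
      _ = _ := by
          rw [lintegral_add_left (by fun_prop), lintegral_const_mul' _ _ ENNReal.ofReal_ne_top]
  have hswap : (∫⁻ x, ∫⁻ y, A (x, y)) ≤
      ENNReal.ofReal (a * (2 * M) ^ N * v) * ∫⁻ x, ENNReal.ofReal (f x) := by
    rw [lintegral_lintegral_swap (f := fun x y => A (x, y)) hA.aemeasurable,
      ← lintegral_const_mul' _ _ ENNReal.ofReal_ne_top]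
    refine lintegral_mono fun y => ?_
    calc (∫⁻ x, A (x, y))
        ≤ ∫⁻ x, (Metric.closedBall (0 : EuclideanSpace ℝ (Fin N)) (2 * M * ‖y‖)).indicator
            (fun _ => ENNReal.ofReal (a * (f y / ‖y‖ ^ N))) x := by
          refine lintegral_mono fun x => indicator_apply_le' (fun hxy => ?_) fun _ => zero_le
          rw [indicator_of_mem]
          rw [mem_closedBall_zero_iff]
          have := hxy.1
          rw [div_div, div_lt_iff₀ (by positivity)] at this
          linarith
      _ = ENNReal.ofReal (a * (f y / ‖y‖ ^ N)) * ENNReal.ofReal ((2 * M * ‖y‖) ^ N * v) := by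
          rw [lintegral_indicator_const Metric.isClosed_closedBall.measurableSet,
            volume_closedBall_zero_eq _ (by positivity)]
      _ ≤ ENNReal.ofReal (a * (2 * M) ^ N * v) * ENNReal.ofReal (f y) := by
          rcases eq_or_ne y 0 with rfl | hy
          · simp [hzero]
          have hy0 : 0 < ‖y‖ := norm_pos_iff.2 hy
          rw [← ENNReal.ofReal_mul (mul_nonneg ha (div_nonneg (hf0 y) (by positivity))),
            ← ENNReal.ofReal_mul (by positivity), mul_pow (2 * M)]
          refine ENNReal.ofReal_le_ofReal (le_of_eq ?_)
          field_simp
  calc ENNReal.ofReal ((1 / M) ^ N * v / 2) * ∫⁻ x, ENNReal.ofReal (f x)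
      = ∫⁻ x, ENNReal.ofReal ((1 / M) ^ N * v / 2) * ENNReal.ofReal (f x) :=
        (lintegral_const_mul' _ _ ENNReal.ofReal_ne_top).symm
    _ ≤ ∫⁻ x, ((∫⁻ y, A (x, y)) + ENNReal.ofReal K * ∫⁻ y, ENNReal.ofReal (G x y)) :=
        lintegral_mono hpoint
    _ = (∫⁻ x, ∫⁻ y, A (x, y)) + ENNReal.ofReal K * ∫⁻ x, ∫⁻ y, ENNReal.ofReal (G x y) := by
        rw [lintegral_add_left hA.lintegral_prod_right',
          lintegral_const_mul' _ _ ENNReal.ofReal_ne_top]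
    _ ≤ _ := by gcongr

theorem ENNReal.le_ofReal_mul_of_absorb {c K : ℝ} (hc : 0 < c) {I J : ENNReal} (hI : I ≠ ⊤)
    (hle : ENNReal.ofReal (2 * c) * I ≤ ENNReal.ofReal c * I + ENNReal.ofReal K * J) :
    I ≤ ENNReal.ofReal (K / c) * J := by
  have hc0 : ENNReal.ofReal c ≠ 0 := (ENNReal.ofReal_pos.2 hc).ne'
  rw [two_mul, ENNReal.ofReal_add hc.le hc.le, add_mul,
    ENNReal.add_le_add_iff_left (ENNReal.mul_ne_top ENNReal.ofReal_ne_top hI)] at hle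
  rw [ENNReal.ofReal_div_of_pos hc, ← ENNReal.mul_div_right_comm,
    ENNReal.le_div_iff_mul_le (Or.inl hc0) (Or.inl ENNReal.ofReal_ne_top), mul_comm]
  exact hle

/-- Weighted fractional Orlicz–Hardy inequality on `ℝ^N \ {0}` for
`γ > N/p⁻_Φ`. -/
theorem weighted_fractional_orlicz_hardy_punctured
    (N : ℕ) (hN : 1 ≤ N) (s α₁ α₂ : ℝ) (hs : s ∈ Ioo (0:ℝ) 1)
    (Φ φ : ℝ → ℝ) (h : IsOrliczPair Φ φ)
    (pm : ℝ) (hpm : IsGLB (orliczRatioSet Φ φ) pm)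
    (γ : ℝ) (hγ : γ = s - α₁ - α₂) (hcrit : (N : ℝ) / pm < γ) :
    ∃ C > 0, ∀ u : EuclideanSpace ℝ (Fin N) → ℝ,
      ContDiff ℝ 1 u → HasCompactSupport u →
      (0 : EuclideanSpace ℝ (Fin N)) ∉ tsupport u →
      (∫⁻ x, ENNReal.ofReal (Φ (|u x| / ‖x‖ ^ γ))) ≤
        ENNReal.ofReal C *
          ∫⁻ x, ∫⁻ y, ENNReal.ofReal
            (Φ (‖x‖ ^ α₁ * ‖y‖ ^ α₂ * (|u x - u y| / ‖x - y‖ ^ s)) /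
              ‖x - y‖ ^ (N:ℝ)) := by
  subst hγ
  have hp1 := h.one_le_of_isGLB hpm
  have hp0 : 0 < pm := one_pos.trans_le hp1
  have hγ0 : 0 ≤ s - α₁ - α₂ := le_trans (by positivity) hcrit.le
  rw [div_lt_iff₀ hp0] at hcrit
  obtain ⟨D, hD, hcompare⟩ := exists_hardy_integrand_le h hpm (EuclideanSpace ℝ (Fin N)) N
    (α₁ := α₁) (α₂ := α₂) hs.1.le hγ0
  obtain ⟨M, hM, hsmall⟩ := exists_large_dilation (D := 4 * 2 ^ N * D) hcrit
  obtain ⟨K, hK, hpoint⟩ := hcompare M hM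
  have hM0 : 0 < M := one_pos.trans hM
  rw [Real.rpow_natCast] at hsmall
  set v := (volume (Metric.ball (0 : EuclideanSpace ℝ (Fin N)) 1)).toReal with hv
  have hv0 : 0 < v :=
    ENNReal.toReal_pos (Metric.measure_ball_pos _ _ one_pos).ne' measure_ball_lt_top.ne
  have hc : 0 < (1 / M) ^ N * v / 4 := by positivity
  refine ⟨K / ((1 / M) ^ N * v / 4), by positivity, fun u hu hsupp h0 => ?_⟩
  refine ENNReal.le_ofReal_mul_of_absorb hc
    (lintegral_orlicz_ne_top h _ hu.continuous hsupp h0) ?_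
  have hmeas : Measurable u := hu.continuous.measurable
  have key := lintegral_le_of_annulus_comparison hN hM0 (by positivity) hK.le
    (f := fun x => Φ (|u x| / ‖x‖ ^ (s - α₁ - α₂)))
    (h.measurable_comp (by fun_prop) fun x => by positivity)
    (fun x => h.nonneg (by positivity))
    (by simp [image_eq_zero_of_notMem_tsupport h0, h.map_zero]) (hpoint u)
  have hcoef : D * ((1 / M) ^ (s - α₁ - α₂)) ^ pm * (1 / M) ^ N * (2 * M) ^ N * v ≤
      (1 / M) ^ N * v / 4 := by
    have hMN : (1 / M) ^ N * (2 * M) ^ N = 2 ^ N := by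
      rw [← mul_pow]
      congr 1
      field_simp
    calc D * ((1 / M) ^ (s - α₁ - α₂)) ^ pm * (1 / M) ^ N * (2 * M) ^ N * v
        = 4 * 2 ^ N * D * ((1 / M) ^ (s - α₁ - α₂)) ^ pm * v / 4 := by
          rw [mul_assoc _ ((1 / M) ^ N), hMN]
          ring
      _ ≤ (1 / M) ^ N * v / 4 := by gcongr
  rw [show 2 * ((1 / M) ^ N * v / 4) = (1 / M) ^ N * v / 2 by ring]
  refine key.trans ?_
  gcongr
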